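/- arXiv:2501.02726 — 2 statements merged into one kernel-verified Lean document; each statement's English description precedes it below -/
import Mathlib

section
/- Let G be a finite simple graph with an even number of vertices, let m ≥ 0 be an integer, and suppose G is m-extendable, i.e., G has at least 2m+2 vertices and every matching of G consisting of m edges is contained in some perfect matching of G. If M is a matching of G consisting of m+1 edges which is not extendable (no perfect matching of G contains M), then there exists a set S ⊆ V(G) such that S contains every endpoint of every edge of M and |S| = C_o(G − S) + 2m. -/
/-- The number of odd components of the graph obtained from `G` by deleting
the vertex set `S`, i.e. of the subgraph of `G` induced on `Sᶜ`. -/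
noncomputable def cardOddComponents {V : Type} (G : SimpleGraph V) (S : Set V) : ℕ :=
  Nat.card {c : (G.induce Sᶜ).ConnectedComponent // Odd (Nat.card c.supp)}

namespace SimpleGraph

theorem Iso.ncard_oddComponents_eq {V W : Type*} {G : SimpleGraph V} {H : SimpleGraph W}
    (φ : G ≃g H) : G.oddComponents.ncard = H.oddComponents.ncard := by
  rw [← Nat.card_coe_set_eq, ← Nat.card_coe_set_eq]
  refine Nat.card_congr (φ.connectedComponentEquiv.subtypeEquiv fun c ↦ ?_)
  change Odd c.supp.ncard ↔ Odd (φ.connectedComponentEquiv c).supp.ncard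
  rw [← Nat.card_coe_set_eq, ← Nat.card_coe_set_eq,
    Nat.card_congr (ConnectedComponent.isoEquivSupp φ c)]

theorem cardOddComponents_eq {V : Type} (G : SimpleGraph V) (S : Set V) :
    cardOddComponents G S = (G.induce Sᶜ).oddComponents.ncard := by
  rw [← Nat.card_coe_set_eq]
  rfl

/-- Deleting `S` as a subgraph of `⊤` gives the subgraph induced on the complement of `S`. -/
def deleteVertsIsoInduceCompl {V : Type*} (G : SimpleGraph V) (S : Set V) :
    ((⊤ : G.Subgraph).deleteVerts S).coe ≃g G.induce Sᶜ where
  toEquiv := Equiv.subtypeEquivRight fun v ↦ by simp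
  map_rel_iff' := by
    rintro ⟨a, ha⟩ ⟨b, hb⟩
    have ha' : a ∉ S := by simpa using ha
    have hb' : b ∉ S := by simpa using hb
    simp [ha', hb']

/-- Deleting two vertex sets one after the other amounts to deleting their union. -/
def induceInduceComplIso {V : Type*} (G : SimpleGraph V) (A : Set V) (T : Set ↥Aᶜ) :
    (G.induce Aᶜ).induce Tᶜ ≃g G.induce (A ∪ Subtype.val '' T)ᶜ where
  toFun v := ⟨v.1.1, by
    rintro (h | ⟨w, hw, hwv⟩)
    · exact v.1.2 h
    · exact v.2 (Subtype.ext hwv ▸ hw)⟩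
  invFun v := ⟨⟨v.1, fun h ↦ v.2 (Or.inl h)⟩, fun h ↦ v.2 (Or.inr ⟨_, h, rfl⟩)⟩
  left_inv _ := rfl
  right_inv _ := rfl
  map_rel_iff' := Iff.rfl

theorem odd_cardOddComponents_iff {V : Type} [Fintype V] (G : SimpleGraph V) (S : Set V)
    (hV : Even (Fintype.card V)) : Odd (cardOddComponents G S) ↔ Odd S.ncard := by
  have h := S.ncard_add_ncard_compl
  rw [Nat.card_eq_fintype_card] at h
  rw [cardOddComponents_eq, odd_ncard_oddComponents, Nat.card_coe_set_eq]
  rw [← h] at hV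
  grind

namespace Subgraph

variable {V : Type*} {G : SimpleGraph V}

theorem IsMatching.ncard_verts [Finite V] {M : G.Subgraph} (hM : M.IsMatching) :
    M.verts.ncard = 2 * M.edgeSet.ncard := by
  classical
  have := Fintype.ofFinite V
  have hdeg (v : M.verts) : M.coe.degree v = 1 := by
    rw [coe_degree]
    convert isMatching_iff_forall_degree.mp hM v v.2
  have hsum := M.coe.sum_degrees_eq_twice_card_edges
  rw [← image_coe_edgeSet_coe,
    Set.ncard_image_of_injective _ (Sym2.map.injective Subtype.val_injective),
    Set.ncard_eq_toFinset_card' M.coe.edgeSet, ← edgeFinset, ← hsum]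
  convert_to _ = ∑ _v : M.verts, 1
  · exact Finset.sum_congr rfl fun v _ ↦ by convert hdeg v
  · simp [Set.ncard_eq_toFinset_card']

theorem IsMatching.induce_sdiff_pair {M : G.Subgraph} (hM : M.IsMatching) {a b : V}
    (hab : M.Adj a b) : (M.induce (M.verts \ {a, b})).IsMatching := by
  rintro v ⟨hv, hvab⟩
  obtain ⟨w, hw, huniq⟩ := hM hv
  have hwab : w ∉ ({a, b} : Set V) := by
    rintro (rfl | rfl)
    · exact hvab (Or.inr (hM.eq_of_adj_left hw.symm hab))
    · exact hvab (Or.inl (hM.eq_of_adj_right hw hab))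
  exact ⟨w, ⟨⟨hv, hvab⟩, ⟨hw.snd_mem, hwab⟩, hw⟩, fun y hy ↦ huniq y hy.2.2⟩

theorem IsMatching.edgeSet_induce_sdiff_pair {M : G.Subgraph} (hM : M.IsMatching) {a b : V}
    (hab : M.Adj a b) :
    (M.induce (M.verts \ {a, b})).edgeSet = M.edgeSet \ {s(a, b)} := by
  ext e
  induction e with | _ x y
  simp only [Subgraph.mem_edgeSet, induce_adj, Set.mem_sdiff, Set.mem_singleton_iff, Sym2.eq_iff,
    Set.mem_insert_iff]
  refine ⟨by grind, fun ⟨h, hne⟩ ↦ ?_⟩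
  have := h.fst_mem
  have := h.snd_mem
  have hxa : x = a → y = b := by rintro rfl; exact hM.eq_of_adj_left h hab
  have hxb : x = b → y = a := by rintro rfl; exact hM.eq_of_adj_left h hab.symm
  have hya : y = a → x = b := by rintro rfl; exact hM.eq_of_adj_left h.symm hab
  have hyb : y = b → x = a := by rintro rfl; exact hM.eq_of_adj_left h.symm hab.symm
  grind

/-- A perfect matching sends the odd components of `G - S` injectively into the vertices of `S`
that it does not match within `S`. -/
theorem IsPerfectMatching.cardOddComponents_add_ncard_le {V : Type} [Finite V]
    {G : SimpleGraph V} {P N : G.Subgraph} (hP : P.IsPerfectMatching) (hN : N.IsMatching)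
    (hNP : N.edgeSet ⊆ P.edgeSet) {S : Set V} (hNS : N.verts ⊆ S) :
    cardOddComponents G S + N.verts.ncard ≤ S.ncard := by
  choose f hfS v hPv hvc using ConnectedComponent.odd_matches_node_outside hP (u := S)
  have hf : Function.Injective f := fun c d hcd ↦ Subtype.ext <| by
    have hvv : v c = v d := Subtype.ext (hP.1.eq_of_adj_right (hPv c) (hcd ▸ hPv d))
    rw [← (ConnectedComponent.mem_supp_iff _ _).mp (hvc c), hvv,
      (ConnectedComponent.mem_supp_iff _ _).mp (hvc d)]
  have hfN (c) : f c ∈ S \ N.verts := by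
    refine ⟨hfS c, fun hmem ↦ ?_⟩
    obtain ⟨w, hw, -⟩ := hN hmem
    have hPw : P.Adj (f c) w := hNP (Subgraph.mem_edgeSet.mpr hw)
    exact (v c).2.2 (hP.1.eq_of_adj_left (hPv c).symm hPw ▸ hNS hw.snd_mem)
  have hle := Nat.card_le_card_of_injective (fun c ↦ (⟨f c, hfN c⟩ : ↥(S \ N.verts)))
    fun c d h ↦ hf (congrArg Subtype.val h)
  rw [Nat.card_coe_set_eq, Nat.card_coe_set_eq,
    (deleteVertsIsoInduceCompl G S).ncard_oddComponents_eq, ← cardOddComponents_eq] at hle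
  have := Set.ncard_sdiff_add_ncard_of_subset hNS
  omega

theorem IsMatching.exists_isPerfectMatching_of_induce_compl {M : G.Subgraph}
    (hM : M.IsMatching) {Q : (G.induce M.vertsᶜ).Subgraph} (hQ : Q.IsPerfectMatching) :
    ∃ P : G.Subgraph, P.IsPerfectMatching ∧ M.edgeSet ⊆ P.edgeSet := by
  let ι : G.induce M.vertsᶜ →g G := (Embedding.induce M.vertsᶜ).toHom
  have hQ' : (Q.map ι).IsMatching := hQ.1.map ι Subtype.val_injective
  refine ⟨M ⊔ Q.map ι, ⟨hM.sup hQ' ?_, fun v ↦ ?_⟩, edgeSet_mono le_sup_left⟩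
  · rw [hM.support_eq_verts, hQ'.support_eq_verts, Set.disjoint_left]
    rintro _ hv ⟨w, -, rfl⟩
    exact w.2 hv
  · by_cases hv : v ∈ M.verts
    · exact Or.inl hv
    · exact Or.inr ⟨⟨v, hv⟩, hQ.2 _, rfl⟩

end Subgraph

end SimpleGraph

open SimpleGraph Subgraph

theorem stmt_1 {V : Type} [Fintype V] (G : SimpleGraph V) (m : ℕ)
    (hEven : Even (Fintype.card V))
    (hord : 2 * m + 2 ≤ Fintype.card V)
    (hext : ∀ N : G.Subgraph, N.IsMatching → N.edgeSet.ncard = m →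
      ∃ P : G.Subgraph, P.IsPerfectMatching ∧ N.edgeSet ⊆ P.edgeSet)
    (M : G.Subgraph) (hM : M.IsMatching) (hMcard : M.edgeSet.ncard = m + 1)
    (hnotext : ¬ ∃ P : G.Subgraph, P.IsPerfectMatching ∧ M.edgeSet ⊆ P.edgeSet) :
    ∃ S : Set V, M.support ⊆ S ∧ S.ncard = cardOddComponents G S + 2 * m := by
  classical
  have hverts := hM.ncard_verts
  have hMA := M.verts.ncard_add_ncard_compl
  rw [Nat.card_eq_fintype_card] at hMA
  have hEven' : Even (Nat.card ↥M.vertsᶜ) := by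
    rw [Nat.card_coe_set_eq]
    rw [← hMA, hverts] at hEven
    grind
  obtain ⟨T, hT⟩ := exists_isTutteViolator (G := G.induce M.vertsᶜ)
    (fun _ hQ ↦ hnotext (hM.exists_isPerfectMatching_of_induce_compl hQ)) hEven'
  set S : Set V := M.verts ∪ Subtype.val '' T with hS
  have hScard : S.ncard = M.verts.ncard + T.ncard := by
    rw [hS, Set.ncard_union_eq, Set.ncard_image_of_injective _ Subtype.val_injective]
    rw [Set.disjoint_left]
    rintro _ hv ⟨w, -, rfl⟩
    exact w.2 hv
  rw [IsTutteViolator, (deleteVertsIsoInduceCompl _ T).ncard_oddComponents_eq,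
    (induceInduceComplIso G M.verts T).ncard_oddComponents_eq, ← cardOddComponents_eq] at hT
  have hpar := odd_cardOddComponents_iff G S hEven
  obtain ⟨e, he⟩ : M.edgeSet.Nonempty := Set.nonempty_of_ncard_ne_zero (by omega)
  induction e with | _ a b
  have hN := hM.induce_sdiff_pair he
  have hNedges := hM.edgeSet_induce_sdiff_pair he
  have hNcard : (M.induce (M.verts \ {a, b})).edgeSet.ncard = m := by
    rw [hNedges, Set.ncard_sdiff_singleton_of_mem he, hMcard, Nat.add_sub_cancel]
  obtain ⟨P, hP, hNP⟩ := hext _ hN hNcard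
  have hle := hP.cardOddComponents_add_ncard_le hN hNP (S := S)
    (fun v hv ↦ Or.inl hv.1)
  rw [hN.ncard_verts, hNcard] at hle
  refine ⟨S, hM.support_eq_verts ▸ Set.subset_union_left, ?_⟩
  grind
end

section
/- Let G be a finite simple graph, let m ≥ 0 be an integer, and let M be a matching of G consisting of m+1 edges. If there exists a set S ⊆ V(G) such that S contains every endpoint of every edge of M and |S| ≤ C_o(G − S) + 2m, then M is not extendable, i.e., no perfect matching of G contains M. -/
namespace SimpleGraph

variable {V : Type*} {G : SimpleGraph V}

/-- A finite graph in which every vertex has a unique neighbor has twice as many vertices as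
edges. -/
theorem natCard_eq_two_mul_ncard_edgeSet [Finite V] (h : ∀ v, ∃! w, G.Adj v w) :
    Nat.card V = 2 * G.edgeSet.ncard := by
  classical
  have := Fintype.ofFinite V
  have hdeg (v : V) : G.degree v = 1 := degree_eq_one_iff_existsUnique_adj.2 (h v)
  rw [← G.coe_edgeFinset, Set.ncard_coe_finset, ← G.sum_degrees_eq_twice_card_edges]
  simp [hdeg]

/-- A finite matching covers twice as many vertices as it has edges. -/
theorem Subgraph.IsMatching.ncard_verts_s2 [Finite V] {M : G.Subgraph} (hM : M.IsMatching) :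
    M.verts.ncard = 2 * M.edgeSet.ncard := by
  rw [← M.image_coe_edgeSet_coe,
    Set.ncard_image_of_injective _ (Sym2.map.injective Subtype.val_injective),
    ← Nat.card_coe_set_eq]
  refine natCard_eq_two_mul_ncard_edgeSet fun v ↦ ?_
  obtain ⟨w, hvw, hw⟩ := hM v.2
  exact ⟨⟨w, hvw.snd_mem⟩, hvw, fun y hy ↦ Subtype.ext (hw y hy)⟩

/-- A perfect matching has an edge joining each odd component of `G - S` to `S`. -/
theorem Subgraph.IsPerfectMatching.exists_adj_of_odd_supp [Finite V] {P : G.Subgraph}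
    (hP : P.IsPerfectMatching) {S : Set V} (c : (G.induce Sᶜ).ConnectedComponent)
    (hc : Odd (Nat.card c.supp)) :
    ∃ w ∈ S, ∃ v : ↥Sᶜ, P.Adj w v ∧ v ∈ c.supp := by
  by_contra! h
  have hmatch : (P.induce (Subtype.val '' c.supp)).IsMatching := by
    rintro _ ⟨v, hv, rfl⟩
    obtain ⟨w, hvw, hw⟩ := hP.1 (hP.2 v)
    have hwS : w ∈ Sᶜ := fun hwS ↦ h w hwS v hvw.symm hv
    have hwc : (⟨w, hwS⟩ : ↥Sᶜ) ∈ c.supp :=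
      c.mem_supp_of_adj_mem_supp hv (P.adj_sub hvw)
    exact ⟨w, ⟨⟨v, hv, rfl⟩, ⟨⟨w, hwS⟩, hwc, rfl⟩, hvw⟩, fun _ hy ↦ hw _ hy.2.2⟩
  have hcard := hmatch.ncard_verts_s2
  rw [Subgraph.induce_verts, Set.ncard_image_of_injective _ Subtype.val_injective,
    ← Nat.card_coe_set_eq] at hcard
  exact Nat.not_even_iff_odd.2 hc (hcard ▸ even_two_mul _)

end SimpleGraph

/-- If a perfect matching contains `M` and `S` contains all endpoints of `M`, then the odd
components of `G - S` are matched to distinct vertices of `S` that `M` does not cover. -/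
theorem cardOddComponents_le_ncard_diff_support {V : Type} [Finite V] {G : SimpleGraph V}
    {M P : G.Subgraph} (hP : P.IsPerfectMatching) (hMP : M.edgeSet ⊆ P.edgeSet)
    {S : Set V} (hS : M.support ⊆ S) :
    cardOddComponents G S ≤ (S \ M.support).ncard := by
  choose f hf g hfg hg using
    fun c : {c : (G.induce Sᶜ).ConnectedComponent // Odd (Nat.card c.supp)} ↦
      hP.exists_adj_of_odd_supp c.1 c.2
  have hfM (c) : f c ∉ M.support := fun ⟨x, hx⟩ ↦ by
    have hPx : P.Adj (f c) x :=
      SimpleGraph.Subgraph.mem_edgeSet.1 (hMP (SimpleGraph.Subgraph.mem_edgeSet.2 hx))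
    exact (g c).2 (hP.1.eq_of_adj_left (hfg c) hPx ▸ hS ⟨f c, hx.symm⟩)
  have hinj : Function.Injective f := fun c d hcd ↦ by
    have hgcd : g c = g d :=
      Subtype.val_injective (hP.1.eq_of_adj_left (hfg c) (hcd ▸ hfg d))
    exact Subtype.val_injective
      (SimpleGraph.ConnectedComponent.eq_of_common_vertex (hg c) (hgcd ▸ hg d))
  rw [cardOddComponents, ← Nat.card_coe_set_eq]
  exact Nat.card_le_card_of_injective (fun c ↦ (⟨f c, hf c, hfM c⟩ : ↥(S \ M.support)))
    fun c d hcd ↦ hinj (congrArg Subtype.val hcd)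

theorem stmt_2 {V : Type} [Fintype V] (G : SimpleGraph V) (m : ℕ)
    (M : G.Subgraph) (hM : M.IsMatching) (hMcard : M.edgeSet.ncard = m + 1)
    (S : Set V) (hS : M.support ⊆ S)
    (hcard : S.ncard ≤ cardOddComponents G S + 2 * m) :
    ¬ ∃ P : G.Subgraph, P.IsPerfectMatching ∧ M.edgeSet ⊆ P.edgeSet := by
  rintro ⟨P, hP, hMP⟩
  have hle := cardOddComponents_le_ncard_diff_support hP hMP hS
  have hdiff := Set.ncard_sdiff_add_ncard_of_subset hS
  have hverts := hM.ncard_verts_s2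
  rw [← hM.support_eq_verts] at hverts
  omega
end
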